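/- arXiv:2010.04149 — 2 statements merged into one kernel-verified Lean document; each statement's English description precedes it below -/
import Mathlib

section
/- Let p be a prime number. Let (Ã, d) be a cochain complex of Z/p²Z-modules such that each Ã^n is flat over Z/p²Z, equipped with Z/p²Z-bilinear multiplication maps Ã^i × Ã^j → Ã^{i+j}, (a, b) ↦ a·b, satisfying the graded Leibniz rule d(a·b) = d(a)·b + (−1)^i a·d(b) for all a ∈ Ã^i, b ∈ Ã^j. Let K := Ã/pÃ, a cochain complex of F_p-vector spaces with the induced differential and induced bilinear products. Then: (1) the sequence of cochain complexes 0 → K → Ã → K → 0, where the first map is induced by multiplication by p on Ã and the second is the reduction map, is exact; and (2) its connecting homomorphism β : H^n(K) → H^{n+1}(K) is a derivation in the graded sense: for all x ∈ H^n(K) and y ∈ H^m(K), β(x·y) = β(x)·y + (−1)^n x·β(y), where the product on cohomology is the one induced by the multiplication of K. -/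
/-!
Statement 7: let `p` be a prime and let `(Ã, d)` be a cochain complex of flat
`ℤ/p²ℤ`-modules equipped with bilinear multiplications satisfying the graded
Leibniz rule.  Let `K := Ã/pÃ`.  Then:

(1) the sequence `0 → K → Ã → K → 0` (first map induced by multiplication by
`p`, second map the reduction) is exact.  Since the surjectivity of the
reduction and the identification of the image of the first map with the kernel
of the second are automatic, the content of exactness is precisely that for
every `a ∈ Ã^n` one has `p⬝a = 0 ↔ a ∈ pÃ^n`, which is how we state it.

(2) the connecting (Bockstein) homomorphism `β : H^n(K) → H^{n+1}(K)` is a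
graded derivation.  Concretely: given cocycles of `K` in degrees `n` and `m`
represented by `a ∈ Ã^n`, `b ∈ Ã^m` (i.e. `d a ∈ pÃ`, `d b ∈ pÃ`), and chosen
`a', b', c'` with `p⬝a' = d a`, `p⬝b' = d b`, `p⬝c' = d (a⬝b)` (so that the
reductions of `a', b', c'` represent `β[a], β[b], β[a⬝b]` respectively), the
cohomology classes satisfy `[c'] = [a'⬝b] + (−1)^n [a⬝b']` in `H^{n+m+1}(K)`,
i.e. `c' − (a'⬝b + (−1)^n a⬝b')` is, modulo `pÃ`, a coboundary `d e`.

Index bookkeeping: elements of `A (i+1+j)` and of `A (i+(j+1))` are transported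
to `A (i+j+1)` using `cast` along the corresponding equalities of integers.
-/

/-- In `ℤ/p²ℤ`, the annihilator of `p` is generated by `p`. -/
theorem ZMod.exists_eq_mul_of_prime_mul_eq_zero {p : ℕ} (hp : p.Prime) {r : ZMod (p ^ 2)}
    (hr : (p : ZMod (p ^ 2)) * r = 0) : ∃ s, r = (p : ZMod (p ^ 2)) * s := by
  have : NeZero (p ^ 2) := ⟨pow_ne_zero 2 hp.ne_zero⟩
  rw [← ZMod.natCast_zmod_val r, ← Nat.cast_mul, ZMod.natCast_eq_zero_iff] at hr
  obtain ⟨t, ht⟩ : p ∣ r.val :=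
    Nat.dvd_of_mul_dvd_mul_left hp.pos ((pow_two p).symm.dvd.trans hr)
  exact ⟨t, by rw [← Nat.cast_mul, ← ht, ZMod.natCast_zmod_val]⟩

/-- On a flat `ℤ/p²ℤ`-module, the kernel of multiplication by `p` is its image. -/
theorem Module.Flat.prime_smul_eq_zero_iff {p : ℕ} (hp : p.Prime) {M : Type*} [AddCommGroup M]
    [Module (ZMod (p ^ 2)) M] [Module.Flat (ZMod (p ^ 2)) M] (a : M) :
    (p : ZMod (p ^ 2)) • a = 0 ↔ ∃ b : M, a = (p : ZMod (p ^ 2)) • b := by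
  constructor
  · intro h
    obtain ⟨k, c, y, hy, hc⟩ := Module.Flat.isTrivialRelation_of_sum_smul_eq_zero
      (f := fun _ : Fin 1 ↦ (p : ZMod (p ^ 2))) (x := fun _ ↦ a) (by simpa using h)
    choose s hs using fun j ↦
      ZMod.exists_eq_mul_of_prime_mul_eq_zero hp (r := c 0 j) (by simpa using hc j)
    refine ⟨∑ j, s j • y j, ?_⟩
    rw [Finset.smul_sum]
    exact (hy 0).trans <| Finset.sum_congr rfl fun j _ ↦ by rw [hs j, mul_smul]
  · rintro ⟨b, rfl⟩
    rw [smul_smul, ← pow_two, ← Nat.cast_pow, ZMod.natCast_self, zero_smul]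

/-- Transport between equal degrees of a graded module commutes with scalar multiplication. -/
theorem cast_congrArg_smul {ι R : Type*} {A : ι → Type*} [∀ i, SMul R (A i)] {i j : ι}
    (h : i = j) (r : R) (x : A i) :
    cast (congrArg A h) (r • x) = r • cast (congrArg A h) x := by
  subst h
  rfl

theorem stmt7 (p : ℕ) (hp : p.Prime)
    (A : ℤ → Type) [∀ n, AddCommGroup (A n)] [∀ n, Module (ZMod (p ^ 2)) (A n)]
    (hflat : ∀ n, Module.Flat (ZMod (p ^ 2)) (A n))
    (d : ∀ n, A n →ₗ[ZMod (p ^ 2)] A (n + 1))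
    (hd : ∀ n (a : A n), d (n + 1) (d n a) = 0)
    (mul : ∀ i j, A i →ₗ[ZMod (p ^ 2)] A j →ₗ[ZMod (p ^ 2)] A (i + j))
    (hLeibniz : ∀ (i j : ℤ) (a : A i) (b : A j),
      d (i + j) (mul i j a b) =
        cast (congrArg A (by ring : i + 1 + j = i + j + 1)) (mul (i + 1) j (d i a) b) +
          ((((-1 : ℤˣ) ^ i : ℤˣ) : ℤ)) •
            cast (congrArg A (by ring : i + (j + 1) = i + j + 1)) (mul i (j + 1) a (d j b))) :
    -- (1) exactness of `0 → K → Ã → K → 0`: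
    (∀ (n : ℤ) (a : A n),
        (p : ZMod (p ^ 2)) • a = 0 ↔ ∃ b : A n, a = (p : ZMod (p ^ 2)) • b) ∧
    -- (2) the Bockstein is a graded derivation:
    (∀ (n m : ℤ) (a : A n) (b : A m) (a' : A (n + 1)) (b' : A (m + 1))
        (c' : A (n + m + 1)),
        (p : ZMod (p ^ 2)) • a' = d n a →
        (p : ZMod (p ^ 2)) • b' = d m b →
        (p : ZMod (p ^ 2)) • c' = d (n + m) (mul n m a b) →
        ∃ (e : A (n + m)) (w : A (n + m + 1)),
          c' -
            (cast (congrArg A (by ring : n + 1 + m = n + m + 1)) (mul (n + 1) m a' b) +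
              ((((-1 : ℤˣ) ^ n : ℤˣ) : ℤ)) •
                cast (congrArg A (by ring : n + (m + 1) = n + m + 1)) (mul n (m + 1) a b')) =
            d (n + m) e + (p : ZMod (p ^ 2)) • w) := by
  have exact_p := fun (n : ℤ) (a : A n) ↦
    have := hflat n
    Module.Flat.prime_smul_eq_zero_iff hp a
  refine ⟨exact_p, fun n m a b a' b' c' ha hb hc ↦ ?_⟩
  suffices h : ∃ w : A (n + m + 1), _ = (p : ZMod (p ^ 2)) • w by
    obtain ⟨w, hw⟩ := h
    exact ⟨0, w, by rw [map_zero, zero_add]; exact hw⟩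
  rw [← exact_p, smul_sub, hc, hLeibniz, ← ha, ← hb, map_smul, map_smul, LinearMap.smul_apply,
    cast_congrArg_smul (by ring : n + 1 + m = n + m + 1),
    cast_congrArg_smul (by ring : n + (m + 1) = n + m + 1), smul_add, smul_comm (p : ZMod (p ^ 2)), sub_self]
end

section
/- Let r ≥ 1, a ≥ 0 and 0 ≤ d ≤ a be integers. In the polynomial ring F_2[s_1, …, s_r, t_1, …, t_r] over the field with two elements, for b ≥ 0 and a subset S ⊆ {1, …, r} let e_b(S) := Σ_{T ⊆ S, |T| = b} ∏_{i∈T} t_i (the b-th elementary symmetric polynomial in the variables t_i with i ∈ S). Define u_{2b} := e_b({1, …, r}) for b ≥ 1 and u_{2b+1} := Σ_{m=1}^{r} s_m · e_b({1, …, r} \ {m}) for b ≥ 0. Then u_{4a+1} + Σ_{t=2a−2d}^{2a−1} u_{2a−t} · u_{2a+1+t} = Σ_{m=1}^{r} s_m · e_d({1, …, r} \ {m}) · e_{2a−d}({1, …, r} \ {m}). -/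
/-!
Statement 8: a family of polynomial identities in `F₂[s₁, …, s_r, t₁, …, t_r]`
(the identity family (orth3) from the paper).

We encode the variables as `Fin r ⊕ Fin r`, with `Sum.inl m` being `s_m` and
`Sum.inr i` being `t_i`.
-/

open Finset MvPolynomial

/-- `eSym r b S` is the `b`-th elementary symmetric polynomial in the variables
`t_i` for `i ∈ S`, i.e. `Σ_{T ⊆ S, |T| = b} Π_{i ∈ T} t_i`. -/
noncomputable def eSym (r b : ℕ) (S : Finset (Fin r)) :
    MvPolynomial (Fin r ⊕ Fin r) (ZMod 2) :=
  ∑ T ∈ S.powersetCard b, ∏ i ∈ T, X (Sum.inr i)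

/-- The classes `u_k`:  `u_{2b} = e_b({1,…,r})` and
`u_{2b+1} = Σ_m s_m ⬝ e_b({1,…,r} \ {m})`. -/
noncomputable def uGen (r k : ℕ) : MvPolynomial (Fin r ⊕ Fin r) (ZMod 2) :=
  if k % 2 = 0 then eSym r (k / 2) Finset.univ
  else ∑ m : Fin r, X (Sum.inl m) * eSym r (k / 2) (Finset.univ.erase m)

lemma eSym_zero (r : ℕ) (S : Finset (Fin r)) : eSym r 0 S = 1 := by
  simp [eSym]

/-- Pascal-type recursion: split the subsets of `{1,…,r}` by whether they contain `m`. -/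
lemma eSym_univ_succ (r k : ℕ) (m : Fin r) :
    eSym r (k + 1) univ =
      eSym r (k + 1) (univ.erase m) + X (Sum.inr m) * eSym r k (univ.erase m) := by
  have hm : m ∉ (univ : Finset (Fin r)).erase m := notMem_erase m univ
  unfold eSym
  conv_lhs => rw [← insert_erase (mem_univ m)]
  rw [powersetCard_succ_insert hm, sum_union, sum_image, mul_sum]
  · congr 1
    refine sum_congr rfl fun T hT => prod_insert fun h => hm ?_
    exact (mem_powersetCard.1 hT).1 h
  · intro T hT T' hT' h
    have hT := fun h => hm ((mem_powersetCard.1 (mem_coe.1 hT)).1 h)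
    have hT' := fun h => hm ((mem_powersetCard.1 (mem_coe.1 hT')).1 h)
    rw [← erase_insert hT, ← erase_insert hT', h]
  · rw [disjoint_left]
    intro T hT hT'
    obtain ⟨T', -, rfl⟩ := mem_image.1 hT'
    exact hm ((mem_powersetCard.1 hT).1 (mem_insert_self m T'))

lemma uGen_even (r b : ℕ) : uGen r (2 * b) = eSym r b univ := by
  simp [uGen]

lemma uGen_odd (r b : ℕ) :
    uGen r (2 * b + 1) = ∑ m : Fin r, X (Sum.inl m) * eSym r b (univ.erase m) := by
  have h : (2 * b + 1) / 2 = b := by omega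
  simp [uGen, Nat.add_mod, h]

/-- The two terms that the sum gains when `d` increases by one. -/
lemma sum_eSym_mul_eSym_succ (r d n : ℕ) :
    (∑ m : Fin r, X (Sum.inl m) * eSym r d (univ.erase m) * eSym r (n + 1) (univ.erase m)) +
      (uGen r (2 * (d + 1)) * uGen r (2 * n + 1) +
        uGen r (2 * d + 1) * uGen r (2 * (n + 1))) =
    ∑ m : Fin r, X (Sum.inl m) * eSym r (d + 1) (univ.erase m) * eSym r n (univ.erase m) := by
  rw [uGen_even, uGen_even, uGen_odd, uGen_odd, mul_sum, sum_mul, ← sum_add_distrib,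
    ← sum_add_distrib]
  refine sum_congr rfl fun m _ => ?_
  rw [eSym_univ_succ r d m, eSym_univ_succ r n m]
  have h2 : (2 : MvPolynomial (Fin r ⊕ Fin r) (ZMod 2)) = 0 := CharTwo.two_eq_zero
  linear_combination
    (X (Sum.inl m) * eSym r d (univ.erase m) * eSym r (n + 1) (univ.erase m) +
      X (Sum.inl m) * X (Sum.inr m) * eSym r d (univ.erase m) * eSym r n (univ.erase m)) * h2

/-- The identity
`u_{4a+1} + Σ_{t=2a−2d}^{2a−1} u_{2a−t} u_{2a+1+t}
  = Σ_{m=1}^{r} s_m ⬝ e_d({1,…,r}∖{m}) ⬝ e_{2a−d}({1,…,r}∖{m})`,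
for all `r ≥ 1`, `a ≥ 0` and `0 ≤ d ≤ a`.
(The sum over `t` from `2a-2d` to `2a-1` inclusive is written as a sum over
`t ∈ Ico (2a-2d) (2a)`.) -/
theorem stmt8 (r a d : ℕ) (hr : 1 ≤ r) (hda : d ≤ a) :
    uGen r (4 * a + 1) +
      ∑ t ∈ Finset.Ico (2 * a - 2 * d) (2 * a),
        uGen r (2 * a - t) * uGen r (2 * a + 1 + t) =
    ∑ m : Fin r,
      X (Sum.inl m) * eSym r d (Finset.univ.erase m) *
        eSym r (2 * a - d) (Finset.univ.erase m) := by
  induction d with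
  | zero =>
    rw [show 4 * a + 1 = 2 * (2 * a) + 1 by ring, uGen_odd]
    simp [eSym_zero]
  | succ d ih =>
    obtain ⟨n, hn⟩ : ∃ n, 2 * a = n + d + 1 := ⟨2 * a - d - 1, by omega⟩
    have ih := ih (by omega)
    rw [show 2 * a - d = n + 1 by omega] at ih
    rw [show 2 * a - (d + 1) = n by omega, ← sum_eSym_mul_eSym_succ, ← ih,
      sum_eq_sum_Ico_succ_bot (by omega), sum_eq_sum_Ico_succ_bot (by omega),
      show 2 * a - 2 * (d + 1) + 1 + 1 = 2 * a - 2 * d by omega,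
      show 2 * a - (2 * a - 2 * (d + 1)) = 2 * (d + 1) by omega,
      show 2 * a + 1 + (2 * a - 2 * (d + 1)) = 2 * n + 1 by omega,
      show 2 * a - (2 * a - 2 * (d + 1) + 1) = 2 * d + 1 by omega,
      show 2 * a + 1 + (2 * a - 2 * (d + 1) + 1) = 2 * (n + 1) by omega]
    ring
end
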